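/- Let M be an unmixed finitely generated module of dimension d over a local ring A that is a quotient of a Gorenstein local ring, and assume M does not satisfy Serre's condition S_2. Set M' = D^d(D^d(M)) (the S_2-fication of M). Then the canonical module K_M = D^d(M) is Cohen–Macaulay if and only if M' is Cohen–Macaulay. -/

import Mathlib

open CategoryTheory

noncomputable section

/-- The dimension of a module: Krull dimension of its support. -/
def moduleDim (R : Type) [CommRing R] (M : Type) [AddCommGroup M] [Module R M] :
    WithBot (WithTop ℕ) :=
  Order.krullDim (Module.support R M)

/-- The depth of a module over a local ring: supremum of lengths of regular
sequences on `M` contained in the maximal ideal. -/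
def moduleDepth (R : Type) [CommRing R] [IsLocalRing R] (M : Type) [AddCommGroup M]
    [Module R M] : ℕ∞ :=
  sSup {n : ℕ∞ | ∃ rs : List R, (rs.length : ℕ∞) = n ∧
    (∀ r ∈ rs, r ∈ IsLocalRing.maximalIdeal R) ∧ RingTheory.Sequence.IsRegular M rs}

/-- A module over a local ring is Cohen–Macaulay if it is zero or its depth
equals its (Krull) dimension. -/
def IsCM (R : Type) [CommRing R] [IsLocalRing R] (M : Type) [AddCommGroup M]
    [Module R M] : Prop :=
  Subsingleton M ∨ moduleDim R M = (moduleDepth R M : WithBot ℕ∞)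

/-- `extModule R n M N` is `Ext_R^n(M, N)` as an `R`-module object. -/
def extModule (R : Type) [CommRing R] (n : ℕ) (M N : Type) [AddCommGroup M] [Module R M]
    [AddCommGroup N] [Module R N] : ModuleCat R :=
  ((Ext R (ModuleCat R) n).obj (Opposite.op (ModuleCat.of R M))).obj (ModuleCat.of R N)

/-- A Noetherian local ring `R` of dimension `n` is Gorenstein if
`Ext^i(k, R)` vanishes for `i ≠ n` and is isomorphic to the residue field `k` for `i = n`. -/
def IsGorensteinLocalRing (R : Type) [CommRing R] [IsLocalRing R] : Prop :=
  IsNoetherianRing R ∧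
  ∀ n : ℕ, ringKrullDim R = n →
    (∀ i : ℕ, i ≠ n → Subsingleton ↥(extModule R i (IsLocalRing.ResidueField R) R)) ∧
    Nonempty (extModule R n (IsLocalRing.ResidueField R) R ≅
      ModuleCat.of R (IsLocalRing.ResidueField R))

/-- Serre's condition `S_k` (here `k = 2`): `depth M_P ≥ min(2, dim M_P)` for all primes. -/
def SerreS2 (R : Type) [CommRing R] (M : Type) [AddCommGroup M] [Module R M] : Prop :=
  ∀ (P : Ideal R) [P.IsPrime],
    min 2 (moduleDim (Localization.AtPrime P) (LocalizedModule P.primeCompl M)) ≤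
      ((moduleDepth (Localization.AtPrime P) (LocalizedModule P.primeCompl M) : ℕ∞) :
        WithBot ℕ∞)

/-- A module is unmixed if all its associated primes have the same dimension, `dim M`. -/
def IsUnmixed (A : Type) [CommRing A] (M : Type) [AddCommGroup M] [Module A M] : Prop :=
  ∀ P ∈ associatedPrimes A M, ringKrullDim (A ⧸ P) = moduleDim A M


open Abelian

/-- Degree zero version of `extMk_eq_zero_iff`. -/
lemma extMk_zero_eq_zero {R : Type} [CommRing R] {X Y : ModuleCat.{0} R}
    (P : ProjectiveResolution X) (f : P.complex.X 0 ⟶ Y) (hf : P.complex.d 1 0 ≫ f = 0)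
    (h : P.extMk f 1 rfl hf = 0) : f = 0 := by
  rw [← P.extEquivCohomologyClass.apply_eq_iff_eq,
    ProjectiveResolution.extEquivCohomologyClass_extMk,
    ProjectiveResolution.extEquivCohomologyClass_zero,
    CochainComplex.HomComplex.CohomologyClass.mk_eq_zero_iff,
    CochainComplex.HomComplex.Cocycle.toSingleMk_mem_coboundaries_iff _ _ _ _ _ 1 (by simp)] at h
  obtain ⟨g, hg⟩ := h
  have hz : Limits.IsZero (P.cochainComplex.X 1) :=
    CochainComplex.isZero_of_isStrictlyLE P.cochainComplex 0 1 (by lia)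
  rw [hz.eq_of_src g 0, Limits.comp_zero] at hg
  rw [← cancel_epi (P.cochainComplexXIso (-(0 : ℕ)) 0 rfl).hom, ← hg, Limits.comp_zero]

lemma extMk_iff {R : Type} [CommRing R] {X Y : ModuleCat.{0} R}
    (P : ProjectiveResolution X) (i : ℕ) (f : P.complex.X i ⟶ Y)
    (hf : P.complex.d (i + 1) i ≫ f = 0) :
    P.extMk f (i + 1) rfl hf = 0 ↔
      ∃ g : P.complex.X ((ComplexShape.up ℕ).prev i) ⟶ Y, P.complex.d i _ ≫ g = f := by
  cases i with
  | zero =>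
    have h0 : P.complex.d 0 ((ComplexShape.up ℕ).prev 0) = 0 := P.complex.shape _ _ (by simp)
    constructor
    · intro h
      exact ⟨0, by rw [extMk_zero_eq_zero P f hf h, Limits.comp_zero]⟩
    · rintro ⟨g, hg⟩
      rw [h0, Limits.zero_comp] at hg
      subst hg
      simp
  | succ i => exact P.extMk_eq_zero_iff _ _ _ _ ((ComplexShape.up ℕ).prev (i + 1)) (by simp)

lemma mem_ker_leftComp {R : Type} [CommRing R] {X X' Y : ModuleCat.{0} R} (d : X' ⟶ X)
    (f : LinearMap.ker (Linear.leftComp R Y d)) : d ≫ f.1 = 0 := f.2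

/-- the map from cocycles to `Ext` -/
def cocycleToExt {R : Type} [CommRing R] {X Y : ModuleCat.{0} R}
    (P : ProjectiveResolution X) (i : ℕ) :
    LinearMap.ker (Linear.leftComp R Y (P.complex.d (i + 1) i)) →ₗ[R] Ext X Y i where
  toFun f := P.extMk f.1 (i + 1) rfl (mem_ker_leftComp _ f)
  map_add' f g := (P.add_extMk f.1 g.1 (i + 1) rfl (mem_ker_leftComp _ f)
    (mem_ker_leftComp _ g)).symm
  map_smul' r f := by
    rw [Ext.smul_eq_comp_mk₀, RingHom.id_apply, ProjectiveResolution.extMk_comp_mk₀]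
    congr 1

lemma legacy_ext {R : Type} [CommRing R] (X Y : ModuleCat.{0} R) (i : ℕ) :
    Nonempty ((((_root_.Ext R (ModuleCat R) i).obj (Opposite.op X)).obj Y) ≃ₗ[R]
      Ext X Y i) := by
  let P := projectiveResolution X
  let S' := (P.complex.linearYonedaObj R Y).sc' ((ComplexShape.up ℕ).prev i) i (i + 1)
  let e1 : (((_root_.Ext R (ModuleCat R) i).obj (Opposite.op X)).obj Y) ≅ S'.homology :=
    P.isoExt i Y ≪≫ (ShortComplex.homologyMapIso
      ((P.complex.linearYonedaObj R Y).isoSc' _ i (i + 1) rfl (by simp)))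
  let e2 := e1 ≪≫ S'.moduleCatHomologyIso
  let φ : LinearMap.ker S'.g.hom →ₗ[R] Ext X Y i := cocycleToExt (Y := Y) P i
  have hsurj : Function.Surjective φ := by
    intro α
    obtain ⟨f, hf, rfl⟩ := P.extMk_surjective α (i + 1) rfl
    exact ⟨⟨f, hf⟩, rfl⟩
  have hker : S'.moduleCatToCycles.range = LinearMap.ker φ := by
    apply le_antisymm
    · rintro _ ⟨g, rfl⟩
      exact (extMk_iff P i _ (S'.moduleCatToCycles g).2).2 ⟨g, rfl⟩
    · rintro ⟨f, hf⟩ hf'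
      obtain ⟨g, hg⟩ := (extMk_iff P i f hf).1 hf'
      exact ⟨g, Subtype.ext hg⟩
  let e3 : (S'.moduleCatLeftHomologyData.H : Type) ≃ₗ[R] Ext X Y i :=
    (Submodule.quotEquivOfEq _ _ hker).trans
      (LinearMap.quotKerEquivOfSurjective φ hsurj)
  exact ⟨e2.toLinearEquiv.trans e3⟩

open scoped Pointwise

/-! ### Basic facts about `Ext` over a ring -/

lemma ext_congr {R : Type} [CommRing R] {X X' : ModuleCat.{0} R} (e : X ≃ₗ[R] X')
    (Y : ModuleCat.{0} R) (i : ℕ) : Nonempty (Ext X Y i ≃ₗ[R] Ext X' Y i) := by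
  let f : X ≅ X' := e.toModuleIso
  refine ⟨LinearEquiv.ofLinearMap
    (Ext.bilinearCompOfLinear R X' X Y 0 i i (zero_add i) (Ext.mk₀ f.inv))
    (Ext.bilinearCompOfLinear R X X' Y 0 i i (zero_add i) (Ext.mk₀ f.hom)) ?_ ?_⟩
  · ext α
    simp only [Ext.bilinearCompOfLinear, LinearMap.comp_apply, LinearMap.coe_mk, AddHom.coe_mk,
      Ext.mk₀_comp_mk₀_assoc, Iso.inv_hom_id, Iso.hom_inv_id, Ext.mk₀_id_comp, LinearMap.id_apply]
  · ext α
    simp only [Ext.bilinearCompOfLinear, LinearMap.comp_apply, LinearMap.coe_mk, AddHom.coe_mk,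
      Ext.mk₀_comp_mk₀_assoc, Iso.inv_hom_id, Iso.hom_inv_id, Ext.mk₀_id_comp, LinearMap.id_apply]

lemma smul_comp_left {R : Type} [CommRing R] {X Y : ModuleCat.{0} R} (r : R) {i : ℕ}
    (α : Ext X Y i) : (Ext.mk₀ (r • 𝟙 X)).comp α (zero_add i) = r • α := by
  simp [Ext.mk₀_smul]

lemma ext_smul_eq_zero {R : Type} [CommRing R] {X Y : ModuleCat.{0} R} {r : R}
    (hr : r ∈ Module.annihilator R X) {i : ℕ} (α : Ext X Y i) : r • α = 0 := by
  rw [← smul_comp_left]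
  have : r • 𝟙 X = 0 := by
    simp [← ModuleCat.lsmul_eq_smul_id, Module.mem_annihilator_iff_lsmul_eq_zero.mp hr]
  simp [this]

lemma ext_finite {R : Type} [CommRing R] [IsNoetherianRing R] (Y : ModuleCat.{0} R)
    [Module.Finite R Y] (i : ℕ) (X : ModuleCat.{0} R) [Module.Finite R X] :
    Module.Finite R (Ext X Y i) := by
  induction i generalizing X with
  | zero =>
    exact Module.Finite.equiv
      ((Ext.linearEquiv₀ (R := R)).trans (ModuleCat.homLinearEquiv (S := R))).symm
  | succ i ih =>
    obtain ⟨m, f, hf⟩ := Module.Finite.exists_fin' R X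
    let S : ShortComplex (ModuleCat.{0} R) :=
      ModuleCat.shortComplexOfCompEqZero (LinearMap.ker f).subtype f (by ext x; simp)
    have hS : S.ShortExact :=
      { exact := ModuleCat.shortComplex_exact _ (LinearMap.exact_subtype_ker_map f)
        mono_f := (ModuleCat.mono_iff_injective _).2 (Subtype.val_injective)
        epi_g := (ModuleCat.epi_iff_surjective _).2 hf }
    have : Module.Finite R S.X₁ := inferInstanceAs (Module.Finite R (LinearMap.ker f))
    have hfin := ih S.X₁
    have hproj : Projective S.X₂ :=
      inferInstanceAs (Projective (ModuleCat.of R (Fin m → R)))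
    refine Module.Finite.of_surjective
      (Ext.bilinearCompOfLinear R S.X₃ S.X₁ Y 1 i (i + 1) (add_comm 1 i) hS.extClass) ?_
    intro α
    exact Ext.contravariant_sequence_exact₃ hS Y α (Ext.eq_zero_of_projective _) (add_comm 1 i)

lemma subsingleton_of_smul_surj {R : Type} [CommRing R] [IsLocalRing R] {E : Type}
    [AddCommGroup E] [Module R E] [Module.Finite R E] {x : R}
    (hx : x ∈ IsLocalRing.maximalIdeal R) (h : ∀ a : E, ∃ b : E, x • b = a) :
    Subsingleton E := by
  have : (⊤ : Submodule R E) = ⊥ := by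
    apply Submodule.eq_bot_of_le_smul_of_le_jacobson_bot (IsLocalRing.maximalIdeal R) ⊤
      Module.Finite.fg_top
    · intro a _
      obtain ⟨b, rfl⟩ := h a
      exact Submodule.smul_mem_smul hx trivial
    · exact IsLocalRing.maximalIdeal_le_jacobson _
  exact (Submodule.subsingleton_iff R).1 (subsingleton_of_bot_eq_top this.symm)

section
variable {R : Type} [CommRing R] {X Y : ModuleCat.{0} R} {x : R}

lemma ext_smul_surj_of_reg (hx : IsSMulRegular X x) (i : ℕ)
    (h : Subsingleton (Ext (ModuleCat.of R (QuotSMulTop x X)) Y (i + 1))) (a : Ext X Y i) :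
    ∃ b : Ext X Y i, x • b = a := by
  have hS := hx.smulShortComplex_shortExact
  have h' : Subsingleton (Ext (X.smulShortComplex x).X₃ Y (i + 1)) := h
  obtain ⟨b, hb⟩ := Ext.contravariant_sequence_exact₁ hS Y a (add_comm 1 i)
    (Subsingleton.elim _ _)
  exact ⟨b, (smul_comp_left (X := X) x b).symm.trans hb⟩

lemma ext_regular_of_reg (hx : IsSMulRegular X x) (i : ℕ)
    (h : Subsingleton (Ext (ModuleCat.of R (QuotSMulTop x X)) Y i)) :
    IsSMulRegular (Ext X Y i) x := by
  have hS := hx.smulShortComplex_shortExact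
  have h' : Subsingleton (Ext (X.smulShortComplex x).X₃ Y i) := h
  refine isSMulRegular_iff_right_eq_zero_of_smul.2 fun a ha => ?_
  obtain ⟨b, hb⟩ := Ext.contravariant_sequence_exact₂ hS Y a
    ((smul_comp_left (X := X) x a).trans ha)
  rw [← hb, Subsingleton.elim b 0, Ext.comp_zero]
  rfl

lemma ext_quot_equiv (hx : IsSMulRegular X x) (i : ℕ)
    (h : Subsingleton (Ext X Y (i + 1))) :
    Nonempty (QuotSMulTop x (Ext X Y i) ≃ₗ[R]
      Ext (ModuleCat.of R (QuotSMulTop x X)) Y (i + 1)) := by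
  have hS := hx.smulShortComplex_shortExact
  let δ : Ext X Y i →ₗ[R] Ext (ModuleCat.of R (QuotSMulTop x X)) Y (i + 1) :=
    Ext.bilinearCompOfLinear R (X.smulShortComplex x).X₃ (X.smulShortComplex x).X₁ Y 1 i (i + 1)
      (add_comm 1 i) hS.extClass
  have hsurj : Function.Surjective δ := by
    intro α
    have h' : Subsingleton (Ext (X.smulShortComplex x).X₂ Y (i + 1)) := h
    exact Ext.contravariant_sequence_exact₃ hS Y α (Subsingleton.elim _ _) (add_comm 1 i)
  have hker : x • (⊤ : Submodule R (Ext X Y i)) = LinearMap.ker δ := by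
    ext a
    rw [Submodule.mem_smul_pointwise_iff_exists, LinearMap.mem_ker]
    constructor
    · rintro ⟨b, -, rfl⟩
      rw [← smul_comp_left]
      exact hS.extClass_comp_assoc (h := add_comm 1 i) _
    · intro ha
      obtain ⟨b, hb⟩ := Ext.contravariant_sequence_exact₁ hS Y a (add_comm 1 i) ha
      exact ⟨b, trivial, (smul_comp_left (X := X) x b).symm.trans hb⟩
  exact ⟨(Submodule.quotEquivOfEq _ _ hker).trans (LinearMap.quotKerEquivOfSurjective δ hsurj)⟩

end

lemma ext_mid {R : Type} [CommRing R] {N₁ N₂ N₃ : Type} [AddCommGroup N₁] [Module R N₁]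
    [AddCommGroup N₂] [Module R N₂] [AddCommGroup N₃] [Module R N₃] (f : N₁ →ₗ[R] N₂)
    (g : N₂ →ₗ[R] N₃) (hf : Function.Injective f) (hg : Function.Surjective g)
    (hfg : Function.Exact f g) (Y : ModuleCat.{0} R) (i : ℕ)
    (h1 : Subsingleton (Ext (ModuleCat.of R N₁) Y i))
    (h3 : Subsingleton (Ext (ModuleCat.of R N₃) Y i)) :
    Subsingleton (Ext (ModuleCat.of R N₂) Y i) := by
  let S : ShortComplex (ModuleCat.{0} R) :=
    ModuleCat.shortComplexOfCompEqZero f g hfg.linearMap_comp_eq_zero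
  have hS : S.ShortExact :=
    { exact := ModuleCat.shortComplex_exact _ hfg
      mono_f := (ModuleCat.mono_iff_injective _).2 hf
      epi_g := (ModuleCat.epi_iff_surjective _).2 hg }
  have h1' : Subsingleton (Ext S.X₁ Y i) := h1
  have h3' : Subsingleton (Ext S.X₃ Y i) := h3
  refine subsingleton_of_forall_eq 0 fun a => ?_
  obtain ⟨b, hb⟩ := Ext.contravariant_sequence_exact₂ hS Y a (Subsingleton.elim _ _)
  rw [← hb, Subsingleton.elim b 0, Ext.comp_zero]

/-! ### Vanishing of `Ext` and duality -/

open IsLocalRing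

lemma ext_subsing_congr {R : Type} [CommRing R] {N N' : Type} [AddCommGroup N] [Module R N]
    [AddCommGroup N'] [Module R N'] (e : N ≃ₗ[R] N') {Y : ModuleCat.{0} R} {i : ℕ}
    (h : Subsingleton (Ext (ModuleCat.of R N') Y i)) :
    Subsingleton (Ext (ModuleCat.of R N) Y i) := by
  obtain ⟨f⟩ := ext_congr (X := ModuleCat.of R N) (X' := ModuleCat.of R N') e Y i
  exact f.toEquiv.subsingleton

lemma wb1 {a : WithBot ℕ∞} (ha : a ≠ ⊥) (h : a + 1 ≤ ((0 : ℕ) : WithBot ℕ∞)) : False := by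
  lift a to ℕ∞ using ha
  norm_cast at h
  simp at h
lemma wb2 {a : WithBot ℕ∞} (e : ℕ) (h : a + 1 ≤ ((e + 1 : ℕ) : WithBot ℕ∞)) : a ≤ e := by
  rcases eq_or_ne a ⊥ with rfl | ha
  · exact bot_le
  lift a to ℕ∞ using ha
  norm_cast at h
  have : (a : ℕ∞) ≤ e := by
    rw [Nat.cast_add, Nat.cast_one] at h
    exact (ENat.add_le_add_iff_right (by simp)).1 h
  exact_mod_cast this

lemma ext_vanish {R : Type} [CommRing R] [IsLocalRing R] [IsNoetherianRing R]
    (Y : ModuleCat.{0} R) [Module.Finite R Y] (n : ℕ)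
    (hk : ∀ i, i ≠ n → Subsingleton (Ext (ModuleCat.of R (ResidueField R)) Y i))
    (e : ℕ) : ∀ (N : Type) [AddCommGroup N] [Module R N] [Module.Finite R N],
    Module.supportDim R N ≤ e → ∀ i, (i + e < n ∨ (e = 0 ∧ n < i)) →
      Subsingleton (Ext (ModuleCat.of R N) Y i) := by
  induction e using Nat.strong_induction_on with
  | _ e ih =>
  intro N _ _ hN
  refine IsNoetherianRing.induction_on_isQuotientEquivQuotientPrime R hN
    (motive := fun N _ _ _ => Module.supportDim R N ≤ e →
      ∀ i, (i + e < n ∨ (e = 0 ∧ n < i)) → Subsingleton (Ext (ModuleCat.of R N) Y i)) ?_ ?_ ?_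
  · intro N _ _ _ _ _ i _
    refine subsingleton_of_forall_eq 0 fun a => ?_
    rw [← Ext.mk₀_id_comp a, (ModuleCat.isZero_of_subsingleton (ModuleCat.of R N)).eq_of_src (𝟙 _) 0]
    simp
  · intro N _ _ _ p eqv hdim i hi
    apply ext_subsing_congr eqv
    by_cases hp : p.asIdeal = maximalIdeal R
    · refine ext_subsing_congr (N' := ResidueField R) ?_ (hk i (by omega))
      exact Submodule.quotEquivOfEq _ _ hp
    · obtain ⟨x, hxm, hxp⟩ : ∃ x ∈ maximalIdeal R, x ∉ p.asIdeal := by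
        by_contra! hcon
        exact hp (le_antisymm (le_maximalIdeal p.2.ne_top) hcon)
      have hreg : IsSMulRegular (R ⧸ p.asIdeal) x := by
        refine isSMulRegular_iff_right_eq_zero_of_smul.2 fun a ha => ?_
        obtain ⟨a, rfl⟩ := Ideal.Quotient.mk_surjective a
        rw [Algebra.smul_def, Ideal.Quotient.algebraMap_eq, ← map_mul,
          Ideal.Quotient.eq_zero_iff_mem] at ha
        exact Ideal.Quotient.eq_zero_iff_mem.2 ((p.2.mem_or_mem ha).resolve_left hxp)
      have hd := Module.supportDim_quotSMulTop_succ_eq_supportDim hreg hxm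
      rw [← Module.supportDim_eq_of_equiv eqv] at hd
      have hne : Module.supportDim R (QuotSMulTop x (R ⧸ p.asIdeal)) ≠ ⊥ := by
        intro hbot
        rw [hbot, WithBot.bot_add] at hd
        have := (Module.supportDim_eq_bot_iff_subsingleton R N).1 hd.symm
        exact not_subsingleton (R ⧸ p.asIdeal) eqv.symm.toEquiv.subsingleton
      obtain ⟨e, rfl⟩ : ∃ e', e = e' + 1 := by
        refine Nat.exists_eq_succ_of_ne_zero ?_
        rintro rfl
        exact wb1 hne (hd.le.trans hdim)
      have hd' : Module.supportDim R (QuotSMulTop x (R ⧸ p.asIdeal)) ≤ e :=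
        wb2 e (hd.le.trans hdim)
      have : Module.Finite R (Ext (ModuleCat.of R (R ⧸ p.asIdeal)) Y i) := ext_finite Y i _
      refine subsingleton_of_smul_surj hxm (ext_smul_surj_of_reg hreg i ?_)
      exact ih e (by omega) _ hd' (i + 1) (by omega)
  · intro N₁ _ _ _ N₂ _ _ _ N₃ _ _ _ f g hf hg hfg h1 h3 hd i hi
    exact ext_mid f g hf hg hfg Y i (h1 ((Module.supportDim_le_of_injective f hf).trans hd) i hi)
      (h3 ((Module.supportDim_le_of_surjective g hg).trans hd) i hi)

/-- Being zero or Cohen-Macaulay of dimension `e` -/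
def CMd (R : Type) [CommRing R] [IsLocalRing R] : ℕ → (N : Type) → [AddCommGroup N] →
    [Module R N] → Prop
  | 0, N, _, _ => Module.supportDim R N ≤ 0
  | e + 1, N, _, _ => ∃ x ∈ maximalIdeal R, IsSMulRegular N x ∧ CMd R e (QuotSMulTop x N)

lemma CMd.retract {R : Type} [CommRing R] [IsLocalRing R] (e : ℕ) :
    ∀ (N L : Type) [AddCommGroup N] [Module R N] [AddCommGroup L] [Module R L]
    (f : N →ₗ[R] L) (g : L →ₗ[R] N) (_ : g ∘ₗ f = LinearMap.id), CMd R e L → CMd R e N := by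
  induction e with
  | zero =>
    intro N L _ _ _ _ f g hgf h
    refine (Module.supportDim_le_of_injective f ?_).trans h
    exact Function.LeftInverse.injective (g := g) (LinearMap.congr_fun hgf)
  | succ e ih =>
    intro N L _ _ _ _ f g hgf h
    have hinj : Function.Injective f :=
      Function.LeftInverse.injective (g := g) (LinearMap.congr_fun hgf)
    obtain ⟨x, hx, hreg, hL⟩ := h
    refine ⟨x, hx, fun a b hab => hinj (hreg ?_), ih _ _ (QuotSMulTop.map x f)
      (QuotSMulTop.map x g) ?_ hL⟩
    · simpa using congrArg f hab
    · rw [← QuotSMulTop.map_comp, hgf, QuotSMulTop.map_id]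

lemma CMd.equiv {R : Type} [CommRing R] [IsLocalRing R] {e : ℕ}
    {N L : Type} [AddCommGroup N] [Module R N] [AddCommGroup L] [Module R L]
    (f : N ≃ₗ[R] L) (h : CMd R e L) : CMd R e N :=
  CMd.retract e N L f f.symm (by ext; simp) h

lemma CMd.vanish {R : Type} [CommRing R] [IsLocalRing R] [IsNoetherianRing R]
    (Y : ModuleCat.{0} R) [Module.Finite R Y] (n : ℕ)
    (hk : ∀ i, i ≠ n → Subsingleton (Ext (ModuleCat.of R (ResidueField R)) Y i))
    (e : ℕ) : ∀ (N : Type) [AddCommGroup N] [Module R N] [Module.Finite R N],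
    CMd R e N → ∀ i, i + e ≠ n → Subsingleton (Ext (ModuleCat.of R N) Y i) := by
  induction e with
  | zero =>
    intro N _ _ _ h i hi
    exact ext_vanish Y n hk 0 N h i (by omega)
  | succ e ih =>
    intro N _ _ _ h i hi
    obtain ⟨x, hx, hreg, h⟩ := h
    have : Module.Finite R (Ext (ModuleCat.of R N) Y i) := ext_finite Y i _
    exact subsingleton_of_smul_surj hx (ext_smul_surj_of_reg hreg i (ih _ h (i + 1) (by omega)))

lemma CMd.dual {R : Type} [CommRing R] [IsLocalRing R] [IsNoetherianRing R]
    (Y : ModuleCat.{0} R) [Module.Finite R Y] (n : ℕ)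
    (hk : ∀ i, i ≠ n → Subsingleton (Ext (ModuleCat.of R (ResidueField R)) Y i))
    (e : ℕ) : ∀ (N : Type) [AddCommGroup N] [Module R N] [Module.Finite R N],
    CMd R e N → ∀ i, i + e = n → CMd R e (Ext (ModuleCat.of R N) Y i) := by
  induction e with
  | zero =>
    intro N _ _ _ h i hi
    have : Module.Finite R (Ext (ModuleCat.of R N) Y i) := ext_finite Y i _
    refine le_trans ?_ h
    rw [Module.supportDim_eq_ringKrullDim_quotient_annihilator,
      Module.supportDim_eq_ringKrullDim_quotient_annihilator]
    have hle : Module.annihilator R N ≤ Module.annihilator R (Ext (ModuleCat.of R N) Y i) :=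
      fun r hr => Module.mem_annihilator.2 (ext_smul_eq_zero (X := ModuleCat.of R N) hr)
    exact ringKrullDim_le_of_surjective _ (Ideal.Quotient.factor_surjective hle)
  | succ e ih =>
    intro N _ _ _ h i hi
    obtain ⟨x, hx, hreg, h'⟩ := id h
    refine ⟨x, hx, ext_regular_of_reg hreg i (CMd.vanish Y n hk e _ h' i (by omega)), ?_⟩
    obtain ⟨f⟩ := ext_quot_equiv (X := ModuleCat.of R N) hreg i
      (CMd.vanish Y n hk (e + 1) N h (i + 1) (by omega))
    exact CMd.equiv f (ih _ h' (i + 1) (by omega))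

/-! ### Comparison of `IsCM` and `CMd` -/

open RingTheory.Sequence

lemma cmd_of_regular {R : Type} [CommRing R] [IsLocalRing R] [IsNoetherianRing R] (rs : List R) :
    ∀ (N : Type) [AddCommGroup N] [Module R N] [Module.Finite R N],
    (∀ r ∈ rs, r ∈ maximalIdeal R) → IsRegular N rs →
    Module.supportDim R N ≤ (rs.length : ℕ) → CMd R rs.length N := by
  induction rs with
  | nil => intro N _ _ _ _ _ h; exact h
  | cons x rs ih =>
    intro N _ _ _ hm hreg hd
    rw [isRegular_cons_iff] at hreg
    have hx : x ∈ maximalIdeal R := hm x (by simp)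
    refine ⟨x, hx, hreg.1, ih _ (fun r hr => hm r (by simp [hr])) hreg.2 ?_⟩
    exact wb2 _ ((Module.supportDim_quotSMulTop_succ_eq_supportDim hreg.1 hx).le.trans hd)

lemma CMd.exists_regular {R : Type} [CommRing R] [IsLocalRing R] [IsNoetherianRing R] (e : ℕ) :
    ∀ (N : Type) [AddCommGroup N] [Module R N] [Module.Finite R N] [Nontrivial N],
    CMd R e N → ∃ rs : List R, rs.length = e ∧ (∀ r ∈ rs, r ∈ maximalIdeal R) ∧ IsRegular N rs ∧
      Module.supportDim R N = e := by
  induction e with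
  | zero =>
    intro N _ _ _ _ h
    refine ⟨[], rfl, by simp, IsRegular.nil R N, le_antisymm h ?_⟩
    exact Order.krullDim_nonneg_iff.2 (Module.nonempty_support_of_nontrivial).to_subtype
  | succ e ih =>
    intro N _ _ _ _ h
    obtain ⟨x, hx, hreg, h⟩ := h
    have hd := Module.supportDim_quotSMulTop_succ_eq_supportDim hreg hx
    have : Nontrivial (QuotSMulTop x N) := by
      by_contra hcon
      rw [not_nontrivial_iff_subsingleton, ← Module.supportDim_eq_bot_iff_subsingleton R] at hcon
      rw [hcon, WithBot.bot_add] at hd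
      exact not_subsingleton N ((Module.supportDim_eq_bot_iff_subsingleton R N).1 hd.symm)
    obtain ⟨rs, hl, hm, hr, hdim⟩ := ih _ h
    refine ⟨x :: rs, by simp [hl], by simpa using ⟨hx, hm⟩,
      (isRegular_cons_iff N x rs).2 ⟨hreg, hr⟩, ?_⟩
    rw [← hd, hdim]
    simp

lemma length_le_supportDim {R : Type} [CommRing R] [IsLocalRing R] [IsNoetherianRing R]
    (N : Type) [AddCommGroup N] [Module R N] [Module.Finite R N] (rs : List R)
    (hr : IsRegular N rs) : ((rs.length : ℕ∞) : WithBot ℕ∞) ≤ Module.supportDim R N := by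
  rw [← Module.supportDim_add_length_eq_supportDim_of_isRegular rs hr]
  have : Nontrivial (N ⧸ Ideal.ofList rs • (⊤ : Submodule R N)) :=
    Submodule.Quotient.nontrivial_iff.2 hr.top_ne_smul.symm
  have h0 : 0 ≤ Module.supportDim R (N ⧸ Ideal.ofList rs • (⊤ : Submodule R N)) :=
    Order.krullDim_nonneg_iff.2 (Module.nonempty_support_of_nontrivial).to_subtype
  exact le_add_of_nonneg_left h0

lemma IsCM.exists_cmd {R : Type} [CommRing R] [IsLocalRing R] [IsNoetherianRing R]
    {N : Type} [AddCommGroup N] [Module R N] [Module.Finite R N] (h : IsCM R N) :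
    Subsingleton N ∨ ∃ e, CMd R e N := by
  rcases subsingleton_or_nontrivial N with hs | hs
  · exact Or.inl hs
  right
  have h : Module.supportDim R N = (moduleDepth R N : WithBot ℕ∞) := by
    rcases h with h | h
    · exact absurd h (not_subsingleton N)
    · exact h
  have hlt : moduleDepth R N < ⊤ := by
    have h1 : Module.supportDim R N < ⊤ :=
      (Module.supportDim_le_ringKrullDim R N).trans_lt ringKrullDim_lt_top
    rw [h] at h1
    exact WithBot.coe_lt_coe.1 h1
  have hne : Nonempty {n : ℕ∞ | ∃ rs : List R, (rs.length : ℕ∞) = n ∧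
      (∀ r ∈ rs, r ∈ IsLocalRing.maximalIdeal R) ∧ RingTheory.Sequence.IsRegular N rs} :=
    ⟨⟨0, [], by simp, by simp, RingTheory.Sequence.IsRegular.nil R N⟩⟩
  have hmem := ENat.sSup_mem_of_nonempty_of_lt_top
    (s := {n : ℕ∞ | ∃ rs : List R, (rs.length : ℕ∞) = n ∧
    (∀ r ∈ rs, r ∈ IsLocalRing.maximalIdeal R) ∧ RingTheory.Sequence.IsRegular N rs})
    (by exact hlt)
  obtain ⟨rs, hl, hm, hr⟩ := hmem
  refine ⟨rs.length, cmd_of_regular rs N hm hr ?_⟩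
  rw [h]
  exact (congrArg (fun t : ℕ∞ => (t : WithBot ℕ∞)) hl.symm).le

lemma CMd.isCM {R : Type} [CommRing R] [IsLocalRing R] [IsNoetherianRing R] {e : ℕ}
    {N : Type} [AddCommGroup N] [Module R N] [Module.Finite R N] (h : CMd R e N) : IsCM R N := by
  rcases subsingleton_or_nontrivial N with hs | hs
  · exact Or.inl hs
  right
  obtain ⟨rs, hl, hm, hr, hd⟩ := CMd.exists_regular e N h
  have : moduleDepth R N = e := by
    apply le_antisymm
    · apply sSup_le
      rintro _ ⟨rs', rfl, -, hr'⟩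
      have := length_le_supportDim N rs' hr'
      rw [hd] at this
      exact_mod_cast this
    · exact le_sSup ⟨rs, by rw [hl], hm, hr⟩
  rw [this]
  exact hd

/-! ### `Ext` as `Hom` -/

lemma ext_shift {R : Type} [CommRing R] {N Y : ModuleCat.{0} R} {x : R}
    (hx : IsSMulRegular Y x) (hN : x ∈ Module.annihilator R N) (i : ℕ)
    (h : Subsingleton (Ext N Y i)) :
    Nonempty (Ext N Y (i + 1) ≃ₗ[R] Ext N (ModuleCat.of R (QuotSMulTop x Y)) i) := by
  have hS := hx.smulShortComplex_shortExact
  let δ : Ext N (ModuleCat.of R (QuotSMulTop x Y)) i →ₗ[R] Ext N Y (i + 1) :=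
    (Ext.bilinearCompOfLinear R N (Y.smulShortComplex x).X₃ (Y.smulShortComplex x).X₁ i 1 (i + 1)
      rfl).flip hS.extClass
  refine ⟨(LinearEquiv.ofBijective δ ⟨?_, ?_⟩).symm⟩
  · rw [injective_iff_map_eq_zero]
    intro a ha
    have h' : Subsingleton (Ext N (Y.smulShortComplex x).X₂ i) := h
    obtain ⟨b, hb⟩ := Ext.covariant_sequence_exact₃ N hS a rfl ha
    rw [← hb, Subsingleton.elim b 0, Ext.zero_comp]
    rfl
  · intro a
    refine Ext.covariant_sequence_exact₁ N hS a ?_ rfl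
    exact (Ext.smul_eq_comp_mk₀ a x).symm.trans (ext_smul_eq_zero hN a)

lemma ext_eq_hom {R : Type} [CommRing R] [IsLocalRing R] [IsNoetherianRing R] (rs : List R) :
    ∀ (Y : ModuleCat.{0} R) [Module.Finite R Y], IsRegular Y rs →
    ∃ Y' : ModuleCat.{0} R, ∀ N : ModuleCat.{0} R, Module.Finite R N →
      (∀ r ∈ rs, r ∈ Module.annihilator R N) →
      Nonempty (Ext N Y rs.length ≃ₗ[R] (N →ₗ[R] Y')) := by
  induction rs with
  | nil =>
    intro Y _ _
    exact ⟨Y, fun N _ _ => ⟨(Ext.linearEquiv₀ (R := R)).trans (ModuleCat.homLinearEquiv (S := R))⟩⟩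
  | cons x rs ih =>
    intro Y _ hreg
    have hreg' := (isRegular_cons_iff Y x rs).1 hreg
    obtain ⟨Y', hY'⟩ := ih (ModuleCat.of R (QuotSMulTop x Y)) hreg'.2
    refine ⟨Y', fun N hN hann => ?_⟩
    obtain ⟨f⟩ := hY' N hN (fun r hr => hann r (by simp [hr]))
    have hsub : Subsingleton (Ext N Y rs.length) := by
      refine ModuleCat.subsingleton_ext_of_exists_isRegular (Ideal.ofList (x :: rs)) N ?_ Y
        hreg.top_ne_smul.symm.lt_top (x :: rs) (fun r hr => Ideal.subset_span hr) hreg _ (by simp)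
      rw [Module.support_eq_zeroLocus]
      exact PrimeSpectrum.zeroLocus_anti_mono (Ideal.span_le.2 hann)
    obtain ⟨g⟩ := ext_shift hreg'.1 (hann x (by simp)) rs.length hsub
    exact ⟨g.trans f⟩

lemma hom_retract {R : Type} [CommRing R] (M Y K K' L : Type) [AddCommGroup M] [Module R M]
    [AddCommGroup Y] [Module R Y] [AddCommGroup K] [Module R K] [AddCommGroup K'] [Module R K']
    [AddCommGroup L] [Module R L] (e : K ≃ₗ[R] (M →ₗ[R] Y)) (e' : K' ≃ₗ[R] (K →ₗ[R] Y))
    (e'' : L ≃ₗ[R] (K' →ₗ[R] Y)) :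
    ∃ (f : K →ₗ[R] L) (g : L →ₗ[R] K), g ∘ₗ f = LinearMap.id := by
  -- evaluation `K → Hom(K', Y)` and `M → K'`
  let f₀ : K →ₗ[R] (K' →ₗ[R] Y) := (e' : K' →ₗ[R] (K →ₗ[R] Y)).flip
  let ev : M →ₗ[R] K' := e'.symm.toLinearMap ∘ₗ (e : K →ₗ[R] (M →ₗ[R] Y)).flip
  let g₀ : (K' →ₗ[R] Y) →ₗ[R] K := e.symm.toLinearMap ∘ₗ LinearMap.lcomp R Y ev
  refine ⟨e''.symm.toLinearMap ∘ₗ f₀, g₀ ∘ₗ e''.toLinearMap, ?_⟩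
  ext k
  apply e.injective
  ext m
  simp [f₀, g₀, ev]

lemma supportDim_of_surj {R A : Type} [CommRing R] [CommRing A] (π : R →+* A)
    (hπ : Function.Surjective π)
    (M : Type) [AddCommGroup M] [Module A M] [Module R M] [Module.Finite A M]
    (hcompat : ∀ (r : R) (m : M), π r • m = r • m) :
    Module.Finite R M ∧ Module.supportDim R M = Module.supportDim A M := by
  have hfin : Module.Finite R M := by
    obtain ⟨s, hs⟩ := (Module.Finite.fg_top : (⊤ : Submodule A M).FG)
    refine ⟨s, ?_⟩
    rw [eq_top_iff]
    intro m _
    have hm : m ∈ Submodule.span A (s : Set M) := hs ▸ trivial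
    induction hm using Submodule.span_induction with
    | mem x hx => exact Submodule.subset_span hx
    | zero => exact zero_mem _
    | add x y _ _ hx hy => exact add_mem (hx trivial) (hy trivial)
    | smul a x _ hx =>
      obtain ⟨r, rfl⟩ := hπ a
      rw [hcompat]
      exact Submodule.smul_mem _ r (hx trivial)
  refine ⟨hfin, ?_⟩
  rw [Module.supportDim_eq_ringKrullDim_quotient_annihilator,
    Module.supportDim_eq_ringKrullDim_quotient_annihilator]
  let φ : R →+* A ⧸ Module.annihilator A M := (Ideal.Quotient.mk _).comp π
  have hφ : Function.Surjective φ := Ideal.Quotient.mk_surjective.comp hπ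
  have hker : Module.annihilator R M = RingHom.ker φ := by
    ext r
    simp [φ, RingHom.mem_ker, Ideal.Quotient.eq_zero_iff_mem, Module.mem_annihilator, hcompat]
  rw [hker]
  exact ringKrullDim_eq_of_ringEquiv (RingHom.quotientKerEquivOfSurjective hφ)

lemma extModule_equiv (R : Type) [CommRing R] (i : ℕ) (M N : Type) [AddCommGroup M] [Module R M]
    [AddCommGroup N] [Module R N] :
    Nonempty (extModule R i M N ≃ₗ[R] Ext (ModuleCat.of R M) (ModuleCat.of R N) i) :=
  legacy_ext (ModuleCat.of R M) (ModuleCat.of R N) i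

lemma main_aux {R : Type} [CommRing R] [IsLocalRing R] [IsNoetherianRing R] (n : ℕ)
    (hk : ∀ i, i ≠ n →
      Subsingleton (Ext (ModuleCat.of R (ResidueField R)) (ModuleCat.of R R) i))
    (N : Type) [AddCommGroup N] [Module R N] [Module.Finite R N] (c : ℕ) (h : IsCM R N) :
    Subsingleton (extModule R c N R) ∨ ∃ e, CMd R e (extModule R c N R) := by
  obtain ⟨ε⟩ := extModule_equiv R c N R
  rcases h.exists_cmd with hs | ⟨e, he⟩
  · left
    have : Subsingleton (Ext (ModuleCat.of R N) (ModuleCat.of R R) c) := by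
      refine subsingleton_of_forall_eq 0 fun a => ?_
      rw [← Ext.mk₀_id_comp a,
        (ModuleCat.isZero_of_subsingleton (ModuleCat.of R N)).eq_of_src (𝟙 _) 0]
      simp
    exact ε.toEquiv.subsingleton
  · by_cases hc : c + e = n
    · exact Or.inr ⟨e, CMd.equiv ε (CMd.dual _ n hk e N he c hc)⟩
    · left
      have := CMd.vanish _ n hk e N he c hc
      exact ε.toEquiv.subsingleton

/-- for `M` unmixed of dimension `d` not satisfying `S_2`, with
`M' = D^d(D^d(M))` the `S_2`-fication, `K_M = D^d(M)` is Cohen–Macaulay iff `M'` is. -/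
theorem stmt_4
    (R : Type) [CommRing R] [IsLocalRing R] (hGor : IsGorensteinLocalRing R)
    (n : ℕ) (hn : ringKrullDim R = n)
    (A : Type) [CommRing A] [IsLocalRing A] [IsNoetherianRing A]
    (π : R →+* A) (hπ : Function.Surjective π)
    (M : Type) [AddCommGroup M] [Module A M] [Module R M] [Module.Finite A M]
    (hcompat : ∀ (r : R) (m : M), π r • m = r • m)
    (d : ℕ) (hd : moduleDim A M = d)
    (hunmixed : IsUnmixed A M) (hnotS2 : ¬ SerreS2 A M) :
    IsCM R ↥(extModule R (n - d) M R) ↔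
      IsCM R ↥(extModule R (n - d) (↥(extModule R (n - d) M R)) R) := by
  have hN : IsNoetherianRing R := hGor.1
  have hk : ∀ i, i ≠ n →
      Subsingleton (Ext (ModuleCat.of R (ResidueField R)) (ModuleCat.of R R) i) := by
    intro i hi
    obtain ⟨ε⟩ := extModule_equiv R i (ResidueField R) R
    have := (hGor.2 n hn).1 i hi
    exact ε.symm.toEquiv.subsingleton
  obtain ⟨hfin, hdim⟩ := supportDim_of_surj π hπ M hcompat
  have hdA : Module.supportDim A M = d := hd
  rw [hdA] at hdim
  have hnt : Nontrivial M := by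
    by_contra hcon
    rw [not_nontrivial_iff_subsingleton, ← Module.supportDim_eq_bot_iff_subsingleton R, hdim] at hcon
    exact WithBot.coe_ne_bot hcon
  obtain ⟨rs, hlen, hmem, hreg⟩ := ModuleCat.exists_isRegular_of_exists_subsingleton_ext
    (Module.annihilator R M) (n - d) (ModuleCat.of R R)
    (by
      rw [lt_top_iff_ne_top]
      intro h
      have h' : Module.annihilator R M = ⊤ := by simpa using h
      exact not_subsingleton M (Module.annihilator_eq_top_iff.1 h'))
    (ModuleCat.of R M) Module.support_eq_zeroLocus
    (fun i hi => ext_vanish _ n hk d M hdim.le i (Or.inl (by omega)))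
  obtain ⟨Y', hY'⟩ := ext_eq_hom rs (ModuleCat.of R R) hreg
  rw [hlen] at hY'
  have hfinE : ∀ (N : Type) [AddCommGroup N] [Module R N] [Module.Finite R N],
      Module.Finite R (extModule R (n - d) N R) := by
    intro N _ _ _
    obtain ⟨ε⟩ := extModule_equiv R (n - d) N R
    have := ext_finite (ModuleCat.of R R) (n - d) (ModuleCat.of R N)
    exact Module.Finite.equiv ε.symm
  have hannE : ∀ (N : Type) [AddCommGroup N] [Module R N],
      (∀ r ∈ rs, r ∈ Module.annihilator R N) →
      ∀ r ∈ rs, r ∈ Module.annihilator R (extModule R (n - d) N R) := by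
    intro N _ _ h r hr
    obtain ⟨ε⟩ := extModule_equiv R (n - d) N R
    rw [ε.annihilator_eq]
    exact Module.mem_annihilator.2 (ext_smul_eq_zero (X := ModuleCat.of R N) (h r hr))
  have hE : ∀ (N : Type) [AddCommGroup N] [Module R N] [Module.Finite R N],
      (∀ r ∈ rs, r ∈ Module.annihilator R N) →
      Nonempty (extModule R (n - d) N R ≃ₗ[R] (N →ₗ[R] Y')) := by
    intro N _ _ hf h
    obtain ⟨ε⟩ := extModule_equiv R (n - d) N R
    obtain ⟨f⟩ := hY' (ModuleCat.of R N) hf h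
    exact ⟨ε.trans f⟩
  have hf1 := hfinE M
  have hf2 := hfinE (extModule R (n - d) M R)
  have hf3 := hfinE (extModule R (n - d) (extModule R (n - d) M R) R)
  constructor
  · intro h
    rcases main_aux n hk _ (n - d) h with h | ⟨e, h⟩
    · exact Or.inl h
    · exact h.isCM
  · intro h
    have ha1 := hannE M hmem
    have ha2 := hannE _ ha1
    obtain ⟨e1⟩ := hE M hmem
    obtain ⟨e2⟩ := hE _ ha1
    obtain ⟨e3⟩ := hE _ ha2
    obtain ⟨f, g, hgf⟩ := hom_retract _ _ _ _ _ e1 e2 e3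
    rcases main_aux n hk _ (n - d) h with h | ⟨e, h⟩
    · left
      have hinj : Function.Injective f :=
        Function.LeftInverse.injective (g := g) (LinearMap.congr_fun hgf)
      exact hinj.subsingleton
    · exact (CMd.retract e _ _ f g hgf h).isCM
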